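/- Let ψ be a Boolean formula over variables x_1,…,x_n,y_1,…,y_m and let G_ψ be the two-player cycle arena constructed from ψ with players A and E. Player E has a winning strategy over positional strategy profiles for the objective Muller(ψ) (i.e., a positional strategy s_E such that out(s[E↦s_E])∈Muller(ψ) for every positional profile s) if and only if the quantified formula ∃y_1…y_m ∀x_1…x_n ψ is true. -/

import Mathlib

open scoped Classical

namespace EpistemicRV

/-- Boolean formulas over variables of type `α`. -/
inductive BForm (α : Type) : Type where
  | tru : BForm α
  | fls : BForm α
  | var : α → BForm α
  | not : BForm α → BForm α
  | and : BForm α → BForm α → BForm α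
  | or : BForm α → BForm α → BForm α

/-- Evaluation of a Boolean formula under a truth assignment. -/
def BForm.eval {α : Type} (θ : α → Prop) : BForm α → Prop
  | .tru => True
  | .fls => False
  | .var a => θ a
  | .not f => ¬ (f.eval θ)
  | .and f g => f.eval θ ∧ g.eval θ
  | .or f g => f.eval θ ∨ g.eval θ

/-- Renaming of variables of a Boolean formula. -/
def BForm.map {α β : Type} (h : α → β) : BForm α → BForm β
  | .tru => .tru
  | .fls => .fls
  | .var a => .var (h a)
  | .not f => .not (f.map h)
  | .and f g => .and (f.map h) (g.map h)
  | .or f g => .or (f.map h) (g.map h)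

/-- A game arena: each vertex has an owner, there is an initial vertex and an
edge relation.  (Totality of the edge relation is stated as a separate
hypothesis where needed.) -/
structure Arena (P V : Type) : Type where
  owner : V → P
  v0 : V
  edge : V → V → Prop

/-- A strategy: given the (reversed) past history and the current vertex,
it yields the next vertex.  A history `h v` (ending in the current vertex `v`)
is represented by the pair of the reversed list `h` and `v`. -/
abbrev Strat (V : Type) : Type := List V → V → V

/-- A strategy profile assigns a strategy to every player. -/
abbrev Profile (P V : Type) : Type := P → Strat V

variable {P V : Type}

/-- A strategy respecting the edge relation. -/
def ValidStrat (A : Arena P V) (s : Strat V) : Prop := ∀ h v, A.edge v (s h v)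

/-- A positional strategy only depends on the current vertex. -/
def PositionalStrat (s : Strat V) : Prop := ∀ h h' v, s h v = s h' v

/-- The class Σ of all strategies. -/
def allClass (A : Arena P V) : Set (Strat V) := {s | ValidStrat A s}

/-- The class Pos of positional strategies. -/
def posClass (A : Arena P V) : Set (Strat V) := {s | ValidStrat A s ∧ PositionalStrat s}

/-- Strategy profiles ranging over the class `C` of strategies. -/
def profiles (A : Arena P V) (C : Set (Strat V)) : Set (Profile P V) :=
  {s | ∀ p, s p ∈ C}

/-- `upd s p t` is the profile `s[p ↦ t]`. -/
noncomputable def upd (s : Profile P V) (p : P) (t : Strat V) : Profile P V :=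
  fun q => if q = p then t else s q

/-- The reversed history of length `n+1` generated by the profile `s`. -/
def histOf (A : Arena P V) (s : Profile P V) : ℕ → List V
  | 0 => [A.v0]
  | n + 1 =>
    match histOf A s n with
    | [] => [A.v0]
    | v :: h => s (A.owner v) h v :: v :: h

/-- The outcome play `out(s)` of the profile `s`. -/
def Out (A : Arena P V) (s : Profile P V) : ℕ → V :=
  fun n => (histOf A s n).getD 0 A.v0

/-- The set of plays of an arena. -/
def plays (A : Arena P V) : Set (ℕ → V) :=
  {ρ | ρ 0 = A.v0 ∧ ∀ i, A.edge (ρ i) (ρ (i + 1))}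

/-- `Inf(ρ)`: the set of vertices occurring infinitely often in `ρ`. -/
def InfSet (ρ : ℕ → V) : Set V := {v | ∀ i, ∃ j, i ≤ j ∧ ρ j = v}

/-- The Büchi objective for the set `U` of vertices. -/
def Buchi (U : Set V) : Set (ℕ → V) := {ρ | (InfSet ρ ∩ U).Nonempty}

/-- The Muller objective for a Boolean formula over the vertices. -/
def Muller (φ : BForm V) : Set (ℕ → V) := {ρ | φ.eval (fun v => v ∈ InfSet ρ)}

/-- `s` is a Nash equilibrium for the objective profile `O` and the class `C`. -/
def NashEq (A : Arena P V) (O : P → Set (ℕ → V)) (C : Set (Strat V))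
    (s : Profile P V) : Prop :=
  ∀ p, ∀ t ∈ C, Out A (upd s p t) ∈ O p → Out A s ∈ O p

/-- `t` is a winning strategy of player `p` for objective `Op` over class `C`. -/
def WinningStrat (A : Arena P V) (Op : Set (ℕ → V)) (C : Set (Strat V))
    (p : P) (t : Strat V) : Prop :=
  t ∈ C ∧ ∀ s ∈ profiles A C, Out A (upd s p t) ∈ Op

/-- Knowledge operator of a single accessibility relation. -/
def Kop {W : Type} (R : W → W → Prop) (E : Set W) : Set W :=
  {w | ∀ w', R w w' → w' ∈ E}

/-- Mutual knowledge operator. -/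
def MKop {W : Type} (R : P → W → W → Prop) (E : Set W) : Set W :=
  ⋂ p, Kop (R p) E

/-- Common knowledge operator: `CK(E) = ⋂_{i ≥ 1} MK^i(E)`. -/
def CKop {W : Type} (R : P → W → W → Prop) (E : Set W) : Set W :=
  ⋂ i ∈ Set.Ici (1 : ℕ), (MKop R)^[i] E

/-- Player `p` is rational in world `w` (for arena `A`, objective profile `O`,
class `C`, accessibility relations `R` and strategy assignment `σ`). -/
def RationalIn (A : Arena P V) (O : P → Set (ℕ → V)) (C : Set (Strat V))
    {W : Type} (R : P → W → W → Prop) (σ : W → Profile P V) (p : P) (w : W) : Prop :=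
  ¬ ∃ t ∈ C,
      (∀ w', R p w w' → (Out A (σ w') ∈ O p → Out A (upd (σ w') p t) ∈ O p)) ∧
      (∃ w', R p w w' ∧ Out A (σ w') ∉ O p ∧ Out A (upd (σ w') p t) ∈ O p)

/-- The set of worlds in which every player is rational. -/
def RAT (A : Arena P V) (O : P → Set (ℕ → V)) (C : Set (Strat V))
    {W : Type} (R : P → W → W → Prop) (σ : W → Profile P V) : Set W :=
  {w | ∀ p, RationalIn A O C R σ p w}

/-- An epistemic model for the arena `A` and the class `C` of strategies. -/
structure EModel {P V : Type} (A : Arena P V) (C : Set (Strat V)) : Type 1 where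
  W : Type
  finW : Finite W
  R : P → W → W → Prop
  equivR : ∀ p, Equivalence (R p)
  σ : W → Profile P V
  memC : ∀ w, σ w ∈ profiles A C
  consistent : ∀ p w w', R p w w' → σ w p = σ w' p

/-- The characterization `T_{G,α,S}` of common knowledge of rationality. -/
def Tchar (A : Arena P V) (O : P → Set (ℕ → V)) (C : Set (Strat V)) :
    Set (Profile P V) :=
  {s | ∃ M : EModel A C, ∃ w : M.W,
        w ∈ CKop M.R (RAT A O C M.R M.σ) ∧ M.σ w = s}

end EpistemicRV

namespace EpistemicRV

/-- Vertices of the two-player cycle arena `G_ψ`: choice vertices `a i` and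
literal vertices `x i b` of player `A`, and choice vertices `e j` and literal
vertices `y j b` of player `E` (`b = true` is the positive literal). -/
inductive CycleV (n m : ℕ) : Type where
  | a : Fin n → CycleV n m
  | x : Fin n → Bool → CycleV n m
  | e : Fin m → CycleV n m
  | y : Fin m → Bool → CycleV n m

/-- Edges of the cycle arena:
`a_i → x_i, x̄_i`, `x_i, x̄_i → a_{i+1}` (or `→ e_1` when `i = n`),
`e_j → y_j, ȳ_j`, `y_j, ȳ_j → e_{j+1}` (or `→ a_1` when `j = m`). -/
def cycleEdge {n m : ℕ} : CycleV n m → CycleV n m → Prop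
  | .a i, .x i' _ => i = i'
  | .x i _, .a i' => (i : ℕ) + 1 = (i' : ℕ)
  | .x i _, .e j => (i : ℕ) + 1 = n ∧ (j : ℕ) = 0
  | .e j, .y j' _ => j = j'
  | .y j _, .e j' => (j : ℕ) + 1 = (j' : ℕ)
  | .y j _, .a i' => (j : ℕ) + 1 = m ∧ (i' : ℕ) = 0
  | _, _ => False

/-- The two-player cycle arena: the player `false` is `A` and owns the `a`/`x`
vertices, the player `true` is `E` and owns the `e`/`y` vertices; the initial
vertex is `a_1`. -/
def cycleArena (n m : ℕ) (hn : 0 < n) : Arena Bool (CycleV n m) where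
  owner := fun v =>
    match v with
    | .a _ => false
    | .x _ _ => false
    | .e _ => true
    | .y _ _ => true
  v0 := .a ⟨0, hn⟩
  edge := cycleEdge

/-- The positive literal vertex corresponding to a variable
(`x_i` on the left, `y_j` on the right). -/
def litVertex {n m : ℕ} : Fin n ⊕ Fin m → CycleV n m :=
  Sum.elim (fun i => .x i true) (fun j => .y j true)

/-- The truth assignment `θ_s` corresponding to a positional profile `s`:
a variable is true iff its positive literal vertex is chosen. -/
def thetaOf {n m : ℕ} (s : Profile Bool (CycleV n m)) : Fin n ⊕ Fin m → Prop
  | .inl i => s false [] (.a i) = CycleV.x i true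
  | .inr j => s true [] (.e j) = CycleV.y j true

end EpistemicRV

namespace EpistemicRV

/-- Evaluating a renamed formula amounts to evaluating under the composed assignment. -/
lemma BForm.eval_map {α β : Type} (h : α → β) (θ : β → Prop) (f : BForm α) :
    (f.map h).eval θ ↔ f.eval (θ ∘ h) := by
  induction f with
  | tru => rfl
  | fls => rfl
  | var a => rfl
  | not f ih => exact not_congr ih
  | and f g ihf ihg => exact and_congr ihf ihg
  | or f g ihf ihg => exact or_congr ihf ihg

lemma out_succ {P V : Type} (A : Arena P V) (s : Profile P V)
    (hs : ∀ p, PositionalStrat (s p)) (k : ℕ) :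
    Out A s (k + 1) = s (A.owner (Out A s k)) [] (Out A s k) := by
  have hne : histOf A s k ≠ [] := by
    cases k with
    | zero => simp [histOf]
    | succ k => rw [histOf]; split <;> simp
  obtain ⟨v, h, hv⟩ := List.exists_cons_of_ne_nil hne
  simp only [Out, histOf, hv, List.getD_cons_zero]
  exact hs _ _ _ _

/-- The distance of a vertex from the initial vertex along the cycle. -/
def CycleV.depth {n m : ℕ} : CycleV n m → ℕ
  | .a i => 2 * i
  | .x i _ => 2 * i + 1
  | .e j => 2 * n + 2 * j
  | .y j _ => 2 * n + 2 * j + 1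

lemma CycleV.eq_a_of_depth {n m : ℕ} {v : CycleV n m} {i : Fin n}
    (h : v.depth = 2 * (i : ℕ)) : v = .a i := by
  cases v with
  | a i' => congr 1; ext; simp only [depth] at h; omega
  | x i' b => simp only [depth] at h; omega
  | e j => simp only [depth] at h; omega
  | y j b => simp only [depth] at h; omega

lemma CycleV.eq_e_of_depth {n m : ℕ} {v : CycleV n m} {j : Fin m}
    (h : v.depth = 2 * n + 2 * (j : ℕ)) : v = .e j := by
  cases v with
  | a i => simp only [depth] at h; omega
  | x i b => simp only [depth] at h; omega
  | e j' => congr 1; ext; simp only [depth] at h; omega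
  | y j' b => simp only [depth] at h; omega

lemma CycleV.depth_lt {n m : ℕ} (v : CycleV n m) : v.depth < 2 * n + 2 * m := by
  cases v <;> simp only [depth] <;> omega

lemma cycleEdge_depth {n m : ℕ} {v w : CycleV n m} (h : cycleEdge v w) :
    w.depth = (v.depth + 1) % (2 * n + 2 * m) := by
  have hw := w.depth_lt
  have key : w.depth = v.depth + 1 ∨ (v.depth + 1 = 2 * n + 2 * m ∧ w.depth = 0) := by
    cases v <;> cases w <;> simp only [cycleEdge, CycleV.depth] at h ⊢ <;> grind
  rcases key with h | ⟨h, h'⟩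
  · rw [← h, Nat.mod_eq_of_lt hw]
  · rw [h, h', Nat.mod_self]

section Play

variable {n m : ℕ} {hn : 0 < n} {s : Profile Bool (CycleV n m)}

lemma depth_out (hs : s ∈ profiles (cycleArena n m hn) (posClass (cycleArena n m hn)))
    (k : ℕ) : (Out (cycleArena n m hn) s k).depth = k % (2 * n + 2 * m) := by
  induction k with
  | zero => simp [Out, histOf, cycleArena, CycleV.depth]
  | succ k ih =>
    rw [out_succ _ _ fun p => (hs p).2, cycleEdge_depth ((hs _).1 _ _), ih, Nat.mod_add_mod]

/-- If `v` is the only vertex at its depth, then a vertex `w` one step further along the cycle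
is visited infinitely often iff it is the successor chosen at `v`. -/
lemma mem_infSet_out_iff
    (hs : s ∈ profiles (cycleArena n m hn) (posClass (cycleArena n m hn)))
    {v w : CycleV n m} (hv : ∀ u : CycleV n m, u.depth = v.depth → u = v)
    (hw : w.depth = v.depth + 1) :
    w ∈ InfSet (Out (cycleArena n m hn) s) ↔ s ((cycleArena n m hn).owner v) [] v = w := by
  have hlt := w.depth_lt
  have step : ∀ k, k % (2 * n + 2 * m) = v.depth →
      Out (cycleArena n m hn) s (k + 1) = s ((cycleArena n m hn).owner v) [] v := by
    intro k hk
    rw [out_succ _ _ fun p => (hs p).2, hv _ ((depth_out hs k).trans hk)]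
  constructor
  · intro h
    obtain ⟨k, hk, hkw⟩ := h 1
    obtain ⟨k, rfl⟩ := Nat.exists_eq_add_of_le' hk
    rw [← hkw, step]
    have hd := depth_out hs (k + 1)
    rw [hkw, hw, Nat.add_mod] at hd
    have hN : 1 % (2 * n + 2 * m) = 1 := Nat.mod_eq_of_lt (by omega)
    have hr : k % (2 * n + 2 * m) < 2 * n + 2 * m := Nat.mod_lt _ (by omega)
    rw [hN] at hd
    rcases Nat.lt_or_ge (k % (2 * n + 2 * m) + 1) (2 * n + 2 * m) with hl | hl
    · rw [Nat.mod_eq_of_lt hl] at hd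
      omega
    · rw [show k % (2 * n + 2 * m) + 1 = 2 * n + 2 * m by omega, Nat.mod_self] at hd
      omega
  · intro h i
    refine ⟨(2 * n + 2 * m) * i + v.depth + 1, ?_, ?_⟩
    · have := Nat.le_mul_of_pos_left i (show 0 < 2 * n + 2 * m by omega)
      omega
    · rw [step _ (by rw [Nat.mul_add_mod, Nat.mod_eq_of_lt v.depth_lt]), h]

/-- The outcome of a positional profile satisfies the Muller objective of `ψ` iff the
corresponding truth assignment satisfies `ψ`. -/
lemma out_mem_muller_iff
    (hs : s ∈ profiles (cycleArena n m hn) (posClass (cycleArena n m hn)))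
    (ψ : BForm (Fin n ⊕ Fin m)) :
    Out (cycleArena n m hn) s ∈ Muller (ψ.map litVertex) ↔ ψ.eval (thetaOf s) := by
  have hθ : (fun v => v ∈ InfSet (Out (cycleArena n m hn) s)) ∘ litVertex = thetaOf s := by
    funext z
    apply propext
    cases z with
    | inl i => exact mem_infSet_out_iff hs (v := .a i) (fun u hu => CycleV.eq_a_of_depth hu) rfl
    | inr j => exact mem_infSet_out_iff hs (v := .e j) (fun u hu => CycleV.eq_e_of_depth hu) rfl
  rw [← hθ]
  exact BForm.eval_map _ _ ψ

end Play

/-- The positional strategy choosing literals according to the truth assignments `f` and `g`. -/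
noncomputable def assignStrat {n m : ℕ} (hn : 0 < n) (hm : 0 < m) (f : Fin n → Prop)
    (g : Fin m → Prop) : Strat (CycleV n m) := fun _ v =>
  match v with
  | .a i => .x i (decide (f i))
  | .x i _ => if h : (i : ℕ) + 1 < n then .a ⟨i + 1, h⟩ else .e ⟨0, hm⟩
  | .e j => .y j (decide (g j))
  | .y j _ => if h : (j : ℕ) + 1 < m then .e ⟨j + 1, h⟩ else .a ⟨0, hn⟩

lemma assignStrat_mem_posClass {n m : ℕ} (hn : 0 < n) (hm : 0 < m) (f : Fin n → Prop)
    (g : Fin m → Prop) : assignStrat hn hm f g ∈ posClass (cycleArena n m hn) := by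
  refine ⟨fun _ v => ?_, fun _ _ _ => rfl⟩
  cases v with
  | a i => simp [cycleArena, assignStrat, cycleEdge]
  | e j => simp [cycleArena, assignStrat, cycleEdge]
  | x i b =>
    by_cases h : (i : ℕ) + 1 < n <;> simp only [cycleArena, assignStrat, cycleEdge, h, dite_true,
      dite_false]
    exact ⟨by omega, trivial⟩
  | y j b =>
    by_cases h : (j : ℕ) + 1 < m <;> simp only [cycleArena, assignStrat, cycleEdge, h, dite_true,
      dite_false]
    exact ⟨by omega, trivial⟩

lemma upd_mem_profiles {P V : Type} {A : Arena P V} {C : Set (Strat V)} {s : Profile P V}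
    (hs : s ∈ profiles A C) (p : P) {t : Strat V} (ht : t ∈ C) : upd s p t ∈ profiles A C := by
  intro q
  unfold upd
  split
  · exact ht
  · exact hs q

/-- player `E` has a positional winning strategy for
`Muller(ψ)` over positional profiles iff `∃y ∀x ψ` is true. -/
theorem E_winning_iff_exists_forall (n m : ℕ) (hn : 0 < n) (hm : 0 < m)
    (ψ : BForm (Fin n ⊕ Fin m)) :
    (∃ sE ∈ posClass (cycleArena n m hn),
        ∀ s ∈ profiles (cycleArena n m hn) (posClass (cycleArena n m hn)),
          Out (cycleArena n m hn) (upd s true sE) ∈ Muller (ψ.map litVertex)) ↔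
      (∃ g : Fin m → Prop, ∀ f : Fin n → Prop, ψ.eval (Sum.elim f g)) := by
  constructor
  · rintro ⟨sE, hE, hwin⟩
    refine ⟨fun j => sE [] (.e j) = .y j true, fun f => ?_⟩
    have hs : (fun _ => assignStrat hn hm f fun _ => True) ∈
        profiles (cycleArena n m hn) (posClass (cycleArena n m hn)) :=
      fun _ => assignStrat_mem_posClass hn hm f _
    have h := (out_mem_muller_iff (upd_mem_profiles hs true hE) ψ).1 (hwin _ hs)
    convert h using 1
    funext z
    cases z <;> simp [thetaOf, upd, assignStrat]
  · rintro ⟨g, hg⟩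
    have hE := assignStrat_mem_posClass hn hm (fun _ => True) g
    refine ⟨_, hE, fun s hs => (out_mem_muller_iff (upd_mem_profiles hs true hE) ψ).2 ?_⟩
    convert hg fun i => s false [] (.a i) = .x i true using 1
    funext z
    cases z <;> simp [thetaOf, upd, assignStrat]

end EpistemicRV
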